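/- arXiv:2603.17205 — 4 statements merged into one kernel-verified Lean document; each statement's English description precedes it below -/
import Mathlib

section
/- Let n ≥ 1 and let u, v ∈ ℝⁿ be unit vectors with u ≠ v and u ≠ −v. Then for every k ∈ (0,1), the function f(k) = ⟨k·u + (1−k)·v, u⟩ / ‖k·u + (1−k)·v‖ is differentiable at k and its derivative at k is strictly positive. -/
open scoped RealInnerProductSpace

section Interpolation

variable {E : Type*} [NormedAddCommGroup E] [InnerProductSpace ℝ E] {u v : E}

theorem inner_interpolation_left (hu : ‖u‖ = 1) (k : ℝ) :
    ⟪k • u + (1 - k) • v, u⟫ = k + (1 - k) * ⟪u, v⟫ := by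
  rw [inner_add_left, real_inner_smul_left, real_inner_smul_left, real_inner_self_eq_norm_sq, hu,
    real_inner_comm]
  ring

theorem norm_interpolation (hu : ‖u‖ = 1) (hv : ‖v‖ = 1) (k : ℝ) :
    ‖k • u + (1 - k) • v‖ = √(k ^ 2 + 2 * k * (1 - k) * ⟪u, v⟫ + (1 - k) ^ 2) := by
  rw [← Real.sqrt_sq (norm_nonneg (k • u + (1 - k) • v)), norm_add_sq_real, norm_smul, norm_smul,
    hu, hv, real_inner_smul_left, real_inner_smul_right, mul_one, mul_one, Real.norm_eq_abs,
    Real.norm_eq_abs, sq_abs, sq_abs]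
  ring_nf

end Interpolation

theorem hasDerivAt_interpolation_div_sqrt {c k : ℝ} (hc : 0 < 1 - c ^ 2) (hk : k < 1) :
    ∃ d > 0, HasDerivAt
      (fun x : ℝ ↦ (x + (1 - x) * c) / √(x ^ 2 + 2 * x * (1 - x) * c + (1 - x) ^ 2)) d k := by
  have hq : 0 < k ^ 2 + 2 * k * (1 - k) * c + (1 - k) ^ 2 := by
    have h : 0 < (1 - k) ^ 2 * (1 - c ^ 2) := mul_pos (pow_pos (sub_pos.2 hk) 2) hc
    nlinarith [sq_nonneg (k + (1 - k) * c)]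
  have hx := hasDerivAt_id k
  have hy := hx.const_sub 1
  have hnum : HasDerivAt (fun x : ℝ ↦ x + (1 - x) * c) (1 - c) k :=
    (hx.add (hy.mul_const c)).congr_deriv (by ring)
  have hden : HasDerivAt (fun x : ℝ ↦ x ^ 2 + 2 * x * (1 - x) * c + (1 - x) ^ 2)
      (2 * (k + (1 - 2 * k) * c - (1 - k))) k :=
    (((hx.pow 2).add (((hx.const_mul 2).mul hy).mul_const c)).add (hy.pow 2)).congr_deriv
      (by simp; ring)
  have hs := Real.sqrt_pos.2 hq
  have hs2 := Real.sq_sqrt hq.le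
  refine ⟨_, ?_, hnum.div (hden.sqrt hq.ne') hs.ne'⟩
  refine div_pos ?_ (pow_pos hs 2)
  generalize √(k ^ 2 + 2 * k * (1 - k) * c + (1 - k) ^ 2) = s at hs hs2
  have key : (1 - c) * s - (k + (1 - k) * c) * (2 * (k + (1 - 2 * k) * c - (1 - k)) / (2 * s)) =
      (1 - c ^ 2) * (1 - k) / s := by
    field_simp
    rw [hs2]
    ring
  rw [key]
  exact div_pos (mul_pos hc (sub_pos.2 hk)) hs

theorem stmt_0 (n : ℕ) (hn : 1 ≤ n) (u v : EuclideanSpace ℝ (Fin n))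
    (hu : ‖u‖ = 1) (hv : ‖v‖ = 1) (huv : u ≠ v) (huv' : u ≠ -v)
    (f : ℝ → ℝ)
    (hf : ∀ k : ℝ, f k = ⟪k • u + (1 - k) • v, u⟫ / ‖k • u + (1 - k) • v‖)
    (k : ℝ) (hk : k ∈ Set.Ioo (0 : ℝ) 1) :
    DifferentiableAt ℝ f k ∧ 0 < deriv f k := by
  have hlt : ⟪u, v⟫ < 1 := (inner_lt_one_iff_real_of_norm_eq_one hu hv).2 huv
  have hgt : ⟪u, -v⟫ < 1 :=
    (inner_lt_one_iff_real_of_norm_eq_one hu ((norm_neg v).trans hv)).2 huv'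
  rw [inner_neg_right] at hgt
  obtain ⟨d, hd, h⟩ := hasDerivAt_interpolation_div_sqrt (c := ⟪u, v⟫) (by nlinarith) hk.2
  have hfun : f = fun x : ℝ ↦ (x + (1 - x) * ⟪u, v⟫) /
      √(x ^ 2 + 2 * x * (1 - x) * ⟪u, v⟫ + (1 - x) ^ 2) := by
    funext x
    rw [hf, inner_interpolation_left hu, norm_interpolation hu hv]
  rw [← hfun] at h
  exact ⟨h.differentiableAt, h.deriv.symm ▸ hd⟩
end

section
/- Let n ≥ 1 and let u, v ∈ ℝⁿ be unit vectors with u ≠ v and u ≠ −v, and let f(k) = ⟨k·u + (1−k)·v, u⟩ / ‖k·u + (1−k)·v‖. Then for all a, b ∈ (0,1): f(a) > f(b) if and only if a > b. -/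
open scoped RealInnerProductSpace

theorem Real.strictMono_sin_arctan : StrictMono fun x : ℝ => Real.sin (Real.arctan x) :=
  fun x y hxy => Real.strictMonoOn_sin
    ⟨(Real.neg_pi_div_two_lt_arctan x).le, (Real.arctan_lt_pi_div_two x).le⟩
    ⟨(Real.neg_pi_div_two_lt_arctan y).le, (Real.arctan_lt_pi_div_two y).le⟩
    (Real.arctan_strictMono hxy)

/-- `p / d` is the sine of the angle with tangent `p / r` when `p ^ 2 + r ^ 2 = d ^ 2`. -/
theorem Real.div_eq_sin_arctan {p r d : ℝ} (hr : 0 < r) (hd : 0 ≤ d)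
    (h : d ^ 2 = p ^ 2 + r ^ 2) : p / d = Real.sin (Real.arctan (p / r)) := by
  have hd' : d = r * √(1 + (p / r) ^ 2) := by
    rw [← sq_eq_sq₀ hd (by positivity), mul_pow, Real.sq_sqrt (by positivity), h]
    field_simp
    ring
  rw [Real.sin_arctan, hd', div_div]

/-- The cosine of the angle between `u` and a point of the segment from `v` to `u` is strictly
increasing along the segment. -/
theorem strictMonoOn_inner_div_norm_segment {E : Type*} [NormedAddCommGroup E]
    [InnerProductSpace ℝ E] {u v : E} (hu : ‖u‖ = 1) (hv : ‖v‖ = 1) (huv : u ≠ v)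
    (huv' : u ≠ -v) :
    StrictMonoOn (fun k : ℝ => ⟪k • u + (1 - k) • v, u⟫ / ‖k • u + (1 - k) • v‖)
      (Set.Iio 1) := by
  have hlt : ⟪v, u⟫ < 1 := (inner_lt_one_iff_real_of_norm_eq_one hv hu).2 huv.symm
  have hgt : -⟪v, u⟫ < 1 := by
    rw [← inner_neg_left]
    exact (inner_lt_one_iff_real_of_norm_eq_one (by rwa [norm_neg]) hu).2 huv'.symm
  set c := ⟪v, u⟫ with hc
  have hs : 0 < 1 - c ^ 2 := by nlinarith
  have hs' : 0 < √(1 - c ^ 2) := Real.sqrt_pos.2 hs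
  have hinner (k : ℝ) : ⟪k • u + (1 - k) • v, u⟫ = k + (1 - k) * c := by
    rw [inner_add_left, real_inner_smul_left, real_inner_smul_left, real_inner_self_eq_norm_sq,
      hu, ← hc]
    ring
  have hnorm (k : ℝ) : ‖k • u + (1 - k) • v‖ ^ 2 =
      (k + (1 - k) * c) ^ 2 + ((1 - k) * √(1 - c ^ 2)) ^ 2 := by
    rw [norm_add_sq_real, norm_smul, norm_smul, hu, hv, real_inner_smul_left,
      real_inner_smul_right, real_inner_comm, ← hc, mul_pow (1 - k), Real.sq_sqrt hs.le, mul_one,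
      mul_one, Real.norm_eq_abs, Real.norm_eq_abs, sq_abs, sq_abs]
    ring
  intro b hb a ha hba
  rw [Set.mem_Iio, ← sub_pos] at ha hb
  simp only [hinner]
  rw [Real.div_eq_sin_arctan (mul_pos ha hs') (norm_nonneg _) (hnorm a),
    Real.div_eq_sin_arctan (mul_pos hb hs') (norm_nonneg _) (hnorm b)]
  apply Real.strictMono_sin_arctan
  rw [← div_div, ← div_div]
  gcongr ?_ / _
  rw [div_lt_div_iff₀ hb ha]
  linarith

theorem stmt_3 (n : ℕ) (hn : 1 ≤ n) (u v : EuclideanSpace ℝ (Fin n))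
    (hu : ‖u‖ = 1) (hv : ‖v‖ = 1) (huv : u ≠ v) (huv' : u ≠ -v)
    (f : ℝ → ℝ)
    (hf : ∀ k : ℝ, f k = ⟪k • u + (1 - k) • v, u⟫ / ‖k • u + (1 - k) • v‖)
    (a b : ℝ) (ha : a ∈ Set.Ioo (0 : ℝ) 1) (hb : b ∈ Set.Ioo (0 : ℝ) 1) :
    f a > f b ↔ a > b := by
  rw [hf a, hf b]
  exact (strictMonoOn_inner_div_norm_segment hu hv huv huv').lt_iff_lt hb.2 ha.2
end

section
/- (Theorem 1, SP vs. FT.) Let h ≥ 1 and let μ₁, μ₂ ∈ ℝʰ be unit vectors with μ₁ ≠ μ₂ and μ₁ ≠ −μ₂. Let m, m⁺ be real numbers with 0 < m⁺ < m, and let γ ∈ (0,1). Define w_FT = (m⁺/m)·μ₁ + (1 − m⁺/m)·μ₂ and w_SP = γ·μ₁ + (1 − γ)·μ₂. Then the cosine similarity of the normalized static-pruning query embedding with the true-positive direction exceeds that of standard finetuning, i.e. ⟨w_SP, μ₁⟩ / ‖w_SP‖ > ⟨w_FT, μ₁⟩ / ‖w_FT‖, if and only if γ > m⁺/m. -/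
open scoped RealInnerProductSpace

section InnerProductSpace

variable {E : Type*} [NormedAddCommGroup E] [InnerProductSpace ℝ E]

theorem real_inner_sq_lt_one_of_norm_eq_one {x y : E} (hx : ‖x‖ = 1) (hy : ‖y‖ = 1)
    (hne : x ≠ y) (hne' : x ≠ -y) : ⟪x, y⟫ ^ 2 < 1 := by
  have hlt : ⟪x, y⟫ < 1 := (inner_lt_one_iff_real_of_norm_eq_one hx hy).2 hne
  have hgt : ⟪x, -y⟫ < 1 :=
    (inner_lt_one_iff_real_of_norm_eq_one hx (by rwa [norm_neg])).2 hne'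
  rw [inner_neg_right] at hgt
  nlinarith

/-- The cosine similarity of `t • x + (1 - t) • y` with `x`, where the tangent of the complementary
angle is affine in `t / (1 - t)`. -/
theorem inner_div_norm_combination_eq_sin_arctan {x y : E} (hx : ‖x‖ = 1) (hy : ‖y‖ = 1)
    (hxy : ⟪x, y⟫ ^ 2 < 1) {t : ℝ} (ht : t < 1) :
    ⟪t • x + (1 - t) • y, x⟫ / ‖t • x + (1 - t) • y‖ =
      Real.sin (Real.arctan ((t / (1 - t) + ⟪x, y⟫) / √(1 - ⟪x, y⟫ ^ 2))) := by
  have hb : 0 < 1 - t := sub_pos.2 ht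
  have hS : 0 < √(1 - ⟪x, y⟫ ^ 2) := Real.sqrt_pos.2 (sub_pos.2 hxy)
  have hS2 : √(1 - ⟪x, y⟫ ^ 2) ^ 2 = 1 - ⟪x, y⟫ ^ 2 := Real.sq_sqrt (sub_pos.2 hxy).le
  have hinner : ⟪t • x + (1 - t) • y, x⟫ = t + (1 - t) * ⟪x, y⟫ := by
    rw [inner_add_left, real_inner_smul_left, real_inner_smul_left,
      real_inner_self_eq_norm_sq, hx, real_inner_comm]
    ring
  have hnorm : ‖t • x + (1 - t) • y‖ ^ 2 =
      t ^ 2 + 2 * (t * (1 - t) * ⟪x, y⟫) + (1 - t) ^ 2 := by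
    rw [norm_add_sq_real, norm_smul, norm_smul, real_inner_smul_left, real_inner_smul_right,
      hx, hy, mul_one, mul_one, Real.norm_eq_abs, Real.norm_eq_abs, sq_abs, sq_abs]
    ring
  rw [Real.sin_arctan, hinner]
  generalize ⟪x, y⟫ = c at *
  generalize √(1 - c ^ 2) = S at *
  have hsqrt : √(1 + ((t / (1 - t) + c) / S) ^ 2) =
      ‖t • x + (1 - t) • y‖ / ((1 - t) * S) := by
    rw [← Real.sqrt_sq (by positivity : 0 ≤ ‖t • x + (1 - t) • y‖ / ((1 - t) * S)),
      div_pow _ ((1 - t) * S), hnorm]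
    congr 1
    field_simp
    rw [hS2]
    ring
  rw [hsqrt]
  field_simp

end InnerProductSpace

theorem stmt_4 (h : ℕ) (hh : 1 ≤ h) (μ₁ μ₂ : EuclideanSpace ℝ (Fin h))
    (hμ₁ : ‖μ₁‖ = 1) (hμ₂ : ‖μ₂‖ = 1) (hne : μ₁ ≠ μ₂) (hne' : μ₁ ≠ -μ₂)
    (m mp γ : ℝ) (hmp : 0 < mp) (hm : mp < m) (hγ : γ ∈ Set.Ioo (0 : ℝ) 1)
    (wFT wSP : EuclideanSpace ℝ (Fin h))
    (hFT : wFT = (mp / m) • μ₁ + (1 - mp / m) • μ₂)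
    (hSP : wSP = γ • μ₁ + (1 - γ) • μ₂) :
    ⟪wSP, μ₁⟫ / ‖wSP‖ > ⟪wFT, μ₁⟫ / ‖wFT‖ ↔ γ > mp / m := by
  obtain ⟨-, hγ1⟩ := hγ
  have hp1 : mp / m < 1 := (div_lt_one (hmp.trans hm)).2 hm
  have hc := real_inner_sq_lt_one_of_norm_eq_one hμ₁ hμ₂ hne hne'
  have hS : 0 < √(1 - ⟪μ₁, μ₂⟫ ^ 2) := Real.sqrt_pos.2 (sub_pos.2 hc)
  rw [hFT, hSP, inner_div_norm_combination_eq_sin_arctan hμ₁ hμ₂ hc hγ1,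
    inner_div_norm_combination_eq_sin_arctan hμ₁ hμ₂ hc hp1, gt_iff_lt, gt_iff_lt,
    Real.strictMono_sin_arctan.lt_iff_lt, div_lt_div_iff_of_pos_right hS, add_lt_add_iff_right,
    div_lt_div_iff₀ (sub_pos.2 hp1) (sub_pos.2 hγ1)]
  constructor <;> intro hlt <;> linarith
end

section
/- (Theorem 1, DP vs. FT.) Let h ≥ 1 and let μ₁, μ₂ ∈ ℝʰ be unit vectors with μ₁ ≠ μ₂ and μ₁ ≠ −μ₂. Let m, m⁺, s, β, ρ be real numbers with 0 < m⁺ < m, 0 < s, β > 1, and ρ ∈ [0,1]. Define w_FT = (m⁺/m)·μ₁ + (1 − m⁺/m)·μ₂ and w_DP = (ρ·s·(β−1) + m⁺)·μ₁ + ((1−ρ)·s·(β−1) + m − m⁺)·μ₂. Then ⟨w_DP, μ₁⟩ / ‖w_DP‖ > ⟨w_FT, μ₁⟩ / ‖w_FT‖ if and only if ρ > m⁺/m. -/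
open scoped RealInnerProductSpace

theorem strictMono_div_sqrt_sq_add {d : ℝ} (hd : 0 < d) :
    StrictMono fun t : ℝ => t / √(t ^ 2 + d) := by
  refine strictMono_of_odd_strictMonoOn_nonneg (fun t => by simp [neg_div]) ?_
  intro s hs t _ hst
  have hs : 0 ≤ s := hs
  have hA : 0 < √(s ^ 2 + d) := by positivity
  have hB : 0 < √(t ^ 2 + d) := by positivity
  have ht : 0 < t := hs.trans_lt hst
  simp only
  rw [div_lt_div_iff₀ hA hB]
  refine lt_of_pow_lt_pow_left₀ 2 (by positivity) ?_
  rw [mul_pow, mul_pow, Real.sq_sqrt (by positivity), Real.sq_sqrt (by positivity)]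
  have : s ^ 2 < t ^ 2 := by gcongr
  nlinarith

theorem inner_div_norm_smul_add_smul {E : Type*} [NormedAddCommGroup E] [InnerProductSpace ℝ E]
    {u v : E} (hu : ‖u‖ = 1) (hv : ‖v‖ = 1) (a : ℝ) {b : ℝ} (hb : 0 < b) :
    ⟪a • u + b • v, u⟫ / ‖a • u + b • v‖ =
      (a / b + ⟪u, v⟫) / √((a / b + ⟪u, v⟫) ^ 2 + (1 - ⟪u, v⟫ ^ 2)) := by
  have hnorm : ‖a • u + b • v‖ = b * √((a / b + ⟪u, v⟫) ^ 2 + (1 - ⟪u, v⟫ ^ 2)) := by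
    rw [← Real.sqrt_sq (norm_nonneg (a • u + b • v)), ← Real.sqrt_sq hb.le,
      ← Real.sqrt_mul (sq_nonneg b), Real.sqrt_sq hb.le, norm_add_sq_real]
    simp only [norm_smul, hu, hv, real_inner_smul_left, real_inner_smul_right, mul_one,
      Real.norm_eq_abs, sq_abs]
    congr 1
    field_simp
    ring
  have hinner : ⟪a • u + b • v, u⟫ = b * (a / b + ⟪u, v⟫) := by
    rw [inner_add_left, real_inner_smul_left, real_inner_smul_left, real_inner_self_eq_norm_sq,
      hu, real_inner_comm u v]
    field_simp
  rw [hnorm, hinner, mul_div_mul_left _ _ hb.ne']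

theorem one_sub_inner_sq_pos {E : Type*} [NormedAddCommGroup E] [InnerProductSpace ℝ E]
    {u v : E} (hu : ‖u‖ = 1) (hv : ‖v‖ = 1) (hne : u ≠ v) (hne' : u ≠ -v) :
    0 < 1 - ⟪u, v⟫ ^ 2 := by
  have hlt : ⟪u, v⟫ < 1 := (inner_lt_one_iff_real_of_norm_eq_one hu hv).2 hne
  have hgt : ⟪u, -v⟫ < 1 := (inner_lt_one_iff_real_of_norm_eq_one hu (by rwa [norm_neg])).2 hne'
  rw [inner_neg_right] at hgt
  nlinarith

theorem stmt_5 (h : ℕ) (hh : 1 ≤ h) (μ₁ μ₂ : EuclideanSpace ℝ (Fin h))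
    (hμ₁ : ‖μ₁‖ = 1) (hμ₂ : ‖μ₂‖ = 1) (hne : μ₁ ≠ μ₂) (hne' : μ₁ ≠ -μ₂)
    (m mp s β ρ : ℝ) (hmp : 0 < mp) (hm : mp < m) (hs : 0 < s) (hβ : 1 < β)
    (hρ : ρ ∈ Set.Icc (0 : ℝ) 1)
    (wFT wDP : EuclideanSpace ℝ (Fin h))
    (hFT : wFT = (mp / m) • μ₁ + (1 - mp / m) • μ₂)
    (hDP : wDP = (ρ * s * (β - 1) + mp) • μ₁ + ((1 - ρ) * s * (β - 1) + m - mp) • μ₂) :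
    ⟪wDP, μ₁⟫ / ‖wDP‖ > ⟪wFT, μ₁⟫ / ‖wFT‖ ↔ ρ > mp / m := by
  have hm0 : 0 < m := hmp.trans hm
  have hk : 0 < s * (β - 1) := mul_pos hs (sub_pos.2 hβ)
  have hbFT : 0 < 1 - mp / m := sub_pos.2 ((div_lt_one hm0).2 hm)
  have hbDP : 0 < (1 - ρ) * s * (β - 1) + m - mp := by
    have := mul_nonneg (sub_nonneg.2 hρ.2) hk.le
    linarith
  rw [hFT, hDP, inner_div_norm_smul_add_smul hμ₁ hμ₂ _ hbFT,
    inner_div_norm_smul_add_smul hμ₁ hμ₂ _ hbDP, gt_iff_lt, gt_iff_lt,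
    (strictMono_div_sqrt_sq_add (one_sub_inner_sq_pos hμ₁ hμ₂ hne hne')).lt_iff_lt,
    add_lt_add_iff_right, div_lt_div_iff₀ hbFT hbDP, ← sub_pos, ← sub_pos (b := mp / m)]
  have key : (ρ * s * (β - 1) + mp) * (1 - mp / m) -
      mp / m * ((1 - ρ) * s * (β - 1) + m - mp) = s * (β - 1) * (ρ - mp / m) := by
    field_simp
    ring
  rw [key, mul_pos_iff_of_pos_left hk]
end
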